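/- Let d ≥ 4 be an even integer, n ≥ 1, let X₁, …, Xₙ be independent standard normal random variables, and let μ be the distribution of X = Σ_{k=1}^n X_k^d, i.e. the pushforward of the n-fold product of the standard Gaussian measure on ℝⁿ under x ↦ Σ_{k=1}^n x_k^d. Then there is ε₀ > 0 such that for every 0 < ε < ε₀, the function g : ℝ → ℂ defined by g(x) = (1/(2π)) ( ψ(x; ε, π+ε, −εd) − ψ(x; −ε, π−ε, π+εd) ) for x > 0 and g(x) = (1/(2π)) ( ψ(x; 0, π, εd) − ψ(x; 0, π, π−εd) ) for x < 0 (and g(0) = 0, say) is real-valued almost everywhere and is a density of μ with respect to Lebesgue measure: μ(A) = ∫_A g(x) dx for every Borel set A ⊆ ℝ. -/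

import Mathlib

open MeasureTheory Complex Filter Topology ProbabilityTheory

noncomputable def phiTheta (d : ℕ) (θ : ℝ) (w : ℂ) : ℂ :=
  (1 / Real.sqrt (2 * Real.pi)) *
    ∫ t in Set.Ioi (0 : ℝ),
      Complex.exp (Complex.I * w * Complex.exp (Complex.I * θ * d) * (t : ℂ) ^ d
          - (1 / 2) * Complex.exp (2 * Complex.I * θ) * (t : ℂ) ^ 2) *
        Complex.exp (Complex.I * θ)

noncomputable def psiFn (d n : ℕ) (θ θ' φ : ℝ) (z : ℂ) : ℂ :=
  ∫ s in Set.Ioi (0 : ℝ),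
    Complex.exp (-Complex.I * z * Complex.exp (Complex.I * φ) * s) *
        (phiTheta d θ (Complex.exp (Complex.I * φ) * s) -
          phiTheta d θ' (Complex.exp (Complex.I * φ) * s)) ^ n *
      Complex.exp (Complex.I * φ)

theorem integral_Ioi_zero_eq_integral_comp_exp {E : Type*} [NormedAddCommGroup E]
    [NormedSpace ℝ E] (h : ℝ → E) :
    ∫ s in Set.Ioi (0 : ℝ), h s = ∫ u : ℝ, Real.exp u • h (Real.exp u) := by
  have := integral_image_eq_integral_abs_deriv_smul (s := Set.univ) (f := Real.exp)
    (f' := Real.exp) MeasurableSet.univ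
    (fun x _ => (Real.hasDerivAt_exp x).hasDerivWithinAt) Real.exp_injective.injOn h
  simpa [Set.image_univ, Real.range_exp, abs_of_pos (Real.exp_pos _)] using this

theorem integrable_comp_exp_iff {E : Type*} [NormedAddCommGroup E]
    [NormedSpace ℝ E] (h : ℝ → E) :
    Integrable (fun u : ℝ => Real.exp u • h (Real.exp u)) ↔ IntegrableOn h (Set.Ioi (0 : ℝ)) := by
  have := integrableOn_image_iff_integrableOn_abs_deriv_smul (s := Set.univ) (f := Real.exp)
    (f' := Real.exp) MeasurableSet.univ
    (fun x _ => (Real.hasDerivAt_exp x).hasDerivWithinAt) Real.exp_injective.injOn h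
  simpa [Set.image_univ, Real.range_exp, abs_of_pos (Real.exp_pos _)] using this.symm

/-- Integrals over two rays from the origin agree, for a function which is holomorphic and
exponentially decaying in the sector between them. -/
theorem integral_ray_eq_integral_ray {f : ℂ → ℂ} {U : Set ℂ} {a b c C : ℝ} (hab : a ≤ b)
    (hc : 0 < c) (hU : ∀ η ∈ Set.Icc a b, ∀ r : ℝ, 0 < r → cexp (I * η) * r ∈ U)
    (hcont : ContinuousOn f U)
    (hdiff : ∀ η ∈ Set.Ioo a b, ∀ r : ℝ, 0 < r → DifferentiableAt ℂ f (cexp (I * η) * r))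
    (hbd : ∀ η ∈ Set.Icc a b, ∀ r : ℝ, 0 < r → ‖f (cexp (I * η) * r)‖ ≤ C * Real.exp (-c * r)) :
    ∫ s in Set.Ioi (0 : ℝ), f (cexp (I * a) * s) * cexp (I * a) =
      ∫ s in Set.Ioi (0 : ℝ), f (cexp (I * b) * s) * cexp (I * b) := by
  set F : ℂ → ℂ := fun z => f (cexp z) * cexp z with hF
  have hexp : ∀ z : ℂ, cexp z = cexp (I * z.im) * (Real.exp z.re : ℝ) := by
    intro z
    rw [Complex.ofReal_exp, ← Complex.exp_add]
    congr 1
    conv_lhs => rw [← Complex.re_add_im z]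
    ring
  have hexp' : ∀ u η : ℝ, cexp (u + η * I) = cexp (I * η) * (Real.exp u : ℝ) := by
    intro u η
    rw [hexp]; simp
  have hFbd : ∀ u : ℝ, ∀ η ∈ Set.Icc a b,
      ‖F (u + η * I)‖ ≤ C * Real.exp (-c * Real.exp u) * Real.exp u := by
    intro u η hη
    simp only [hF]
    rw [norm_mul, Complex.norm_exp]
    have h1 := hbd η hη _ (Real.exp_pos u)
    rw [hexp']
    simp only [add_re, ofReal_re, mul_re, I_re, mul_zero, ofReal_im, I_im, mul_one, sub_self,
      add_zero]
    gcongr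
  have hFc : ContinuousOn F (Set.univ ×ℂ Set.Icc a b) := by
    refine ContinuousOn.mul (hcont.comp Complex.continuous_exp.continuousOn ?_)
      Complex.continuous_exp.continuousOn
    intro z hz
    rw [hexp]
    exact hU _ hz.2 _ (Real.exp_pos _)
  have hFd : DifferentiableOn ℂ F (Set.univ ×ℂ Set.Ioo a b) := by
    intro z hz
    have h1 : DifferentiableAt ℂ f (cexp z) := by
      rw [hexp]; exact hdiff _ hz.2 _ (Real.exp_pos _)
    exact ((h1.comp z Complex.differentiableAt_exp).mul
      Complex.differentiableAt_exp).differentiableWithinAt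
  have hline : ∀ η ∈ Set.Icc a b,
      Integrable (fun u : ℝ => F (u + η * I)) ∧
      ∫ s in Set.Ioi (0 : ℝ), f (cexp (I * η) * s) * cexp (I * η) = ∫ u : ℝ, F (u + η * I) := by
    intro η hη
    have hE : ∀ u : ℝ, F (u + η * I) =
        Real.exp u • (f (cexp (I * η) * (Real.exp u : ℝ)) * cexp (I * η)) := by
      intro u
      simp only [hF]
      rw [hexp', real_smul]; ring
    constructor
    · have hcl : Continuous (fun u : ℝ => F (u + η * I)) := by
        refine hFc.comp_continuous (by fun_prop) ?_
        intro u
        refine ⟨Set.mem_univ _, ?_⟩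
        simpa using hη
      have hb : Integrable (fun u : ℝ => Real.exp u • (C * Real.exp (-c * Real.exp u))) := by
        rw [integrable_comp_exp_iff (fun u => C * Real.exp (-c * u))]
        exact (exp_neg_integrableOn_Ioi 0 hc).const_mul C
      refine hb.mono' hcl.aestronglyMeasurable (ae_of_all _ fun u => ?_)
      refine (hFbd u η hη).trans (le_of_eq ?_)
      rw [smul_eq_mul]; ring
    · simp_rw [hE]
      rw [integral_Ioi_zero_eq_integral_comp_exp
        (fun s : ℝ => f (cexp (I * η) * s) * cexp (I * η))]
  have ha := hline a ⟨le_rfl, hab⟩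
  have hb := hline b ⟨hab, le_rfl⟩
  rw [ha.2, hb.2]
  have hrect : ∀ R : ℝ, 0 ≤ R →
      ‖(∫ u : ℝ in (-R)..R, F (u + a * I)) - ∫ u : ℝ in (-R)..R, F (u + b * I)‖ ≤
      C * Real.exp (-c * Real.exp R) * Real.exp R * |b - a| +
      C * Real.exp (-c * Real.exp (-R)) * Real.exp (-R) * |b - a| := by
    intro R hR
    have h := Complex.integral_boundary_rect_eq_zero_of_continuousOn_of_differentiableOn F
      (⟨-R, a⟩ : ℂ) (⟨R, b⟩ : ℂ)
      (hFc.mono (by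
        intro z hz
        refine ⟨Set.mem_univ _, ?_⟩
        have := hz.2
        rwa [Set.uIcc_of_le hab] at this))
      (hFd.mono (by
        intro z hz
        refine ⟨Set.mem_univ _, ?_⟩
        have := hz.2
        simpa [hab] using this))
    simp only at h
    have h1 : ‖∫ y : ℝ in a..b, F ((R : ℂ) + y * I)‖ ≤
        C * Real.exp (-c * Real.exp R) * Real.exp R * |b - a| := by
      refine intervalIntegral.norm_integral_le_of_norm_le_const ?_
      intro y hy
      rw [Set.uIoc_of_le hab] at hy
      exact hFbd R y ⟨hy.1.le, hy.2⟩
    have h2 : ‖∫ y : ℝ in a..b, F (((-R : ℝ) : ℂ) + y * I)‖ ≤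
        C * Real.exp (-c * Real.exp (-R)) * Real.exp (-R) * |b - a| := by
      refine intervalIntegral.norm_integral_le_of_norm_le_const ?_
      intro y hy
      rw [Set.uIoc_of_le hab] at hy
      exact hFbd (-R) y ⟨hy.1.le, hy.2⟩
    have h3 : (∫ u : ℝ in (-R)..R, F (u + a * I)) - ∫ u : ℝ in (-R)..R, F (u + b * I) =
        I • (∫ y : ℝ in a..b, F (((-R : ℝ) : ℂ) + y * I)) -
          I • ∫ y : ℝ in a..b, F ((R : ℂ) + y * I) := by
      linear_combination h
    rw [h3]
    refine (norm_sub_le _ _).trans ?_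
    rw [norm_smul, norm_smul, norm_I, one_mul, one_mul]
    linarith
  have hlim1 : Tendsto (fun R : ℝ => (∫ u : ℝ in (-R)..R, F (u + a * I)) -
      ∫ u : ℝ in (-R)..R, F (u + b * I)) atTop
      (𝓝 ((∫ u : ℝ, F (u + a * I)) - ∫ u : ℝ, F (u + b * I))) :=
    (intervalIntegral_tendsto_integral ha.1 tendsto_neg_atTop_atBot tendsto_id).sub
      (intervalIntegral_tendsto_integral hb.1 tendsto_neg_atTop_atBot tendsto_id)
  have hlim2 : Tendsto (fun R : ℝ => C * Real.exp (-c * Real.exp R) * Real.exp R * |b - a| +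
      C * Real.exp (-c * Real.exp (-R)) * Real.exp (-R) * |b - a|) atTop (𝓝 0) := by
    have e1 : Tendsto (fun R : ℝ => Real.exp (-c * Real.exp R) * Real.exp R) atTop (𝓝 0) := by
      have h := (Real.tendsto_pow_mul_exp_neg_atTop_nhds_zero 1).comp
        ((tendsto_const_mul_atTop_of_pos hc).2 Real.tendsto_exp_atTop)
      have h' := h.const_mul c⁻¹
      rw [mul_zero] at h'
      refine h'.congr fun R => ?_
      simp only [Function.comp, pow_one]
      field_simp
    have e2 : Tendsto (fun R : ℝ => Real.exp (-c * Real.exp (-R)) * Real.exp (-R)) atTop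
        (𝓝 0) := by
      have h0 : Tendsto (fun R : ℝ => Real.exp (-R)) atTop (𝓝 0) :=
        Real.tendsto_exp_neg_atTop_nhds_zero
      have h1 : Tendsto (fun R : ℝ => Real.exp (-c * Real.exp (-R))) atTop
        (𝓝 (Real.exp (-c * 0))) := (Real.continuous_exp.tendsto _).comp (h0.const_mul (-c))
      simpa using h1.mul h0
    have := ((e1.const_mul C).mul_const |b - a|).add ((e2.const_mul C).mul_const |b - a|)
    simpa [mul_assoc] using this
  have hlim3 := squeeze_zero_norm' ((eventually_ge_atTop 0).mono hrect) hlim2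
  exact sub_eq_zero.1 (tendsto_nhds_unique hlim1 hlim3)

theorem phiTheta_exponent_norm (d : ℕ) (θ : ℝ) (w : ℂ) (t : ℝ) :
    ‖cexp (I * w * cexp (I * θ * d) * (t : ℂ) ^ d
        - (1 / 2) * cexp (2 * I * θ) * (t : ℂ) ^ 2) * cexp (I * θ)‖ =
      Real.exp (-((w * cexp (I * θ * d)).im * t ^ d)) *
        Real.exp (-(Real.cos (2 * θ) / 2) * t ^ 2) := by
  have h1 : ‖cexp (I * θ)‖ = 1 := by
    rw [mul_comm]; exact Complex.norm_exp_ofReal_mul_I θ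
  have h2 : I * w * cexp (I * θ * d) * (t : ℂ) ^ d =
      I * (w * cexp (I * θ * d)) * ((t ^ d : ℝ) : ℂ) := by push_cast; ring
  have h3 : (1 / 2) * cexp (2 * I * θ) * (t : ℂ) ^ 2 =
      cexp (((2 * θ : ℝ) : ℂ) * I) * ((t ^ 2 / 2 : ℝ) : ℂ) := by
    push_cast
    rw [show (2 : ℂ) * I * θ = 2 * θ * I by ring]; ring
  rw [norm_mul, h1, mul_one, Complex.norm_exp, ← Real.exp_add, h2, h3, sub_re, re_mul_ofReal,
    re_mul_ofReal, Complex.exp_ofReal_mul_I_re, I_mul_re]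
  congr 1
  ring

theorem phiTheta_integrand_norm_le {d : ℕ} {θ : ℝ} {w : ℂ}
    (hw : 0 ≤ (w * cexp (I * θ * d)).im) {t : ℝ} (ht : 0 < t) :
    ‖cexp (I * w * cexp (I * θ * d) * (t : ℂ) ^ d
        - (1 / 2) * cexp (2 * I * θ) * (t : ℂ) ^ 2) * cexp (I * θ)‖ ≤
      Real.exp (-(Real.cos (2 * θ) / 2) * t ^ 2) := by
  rw [phiTheta_exponent_norm]
  refine mul_le_of_le_one_left (Real.exp_pos _).le (Real.exp_le_one_iff.2 ?_)
  have := pow_pos ht d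
  nlinarith [mul_nonneg hw this.le]

theorem exists_norm_phiTheta_le (d : ℕ) (θ : ℝ) (hθ : 0 < Real.cos (2 * θ)) :
    ∃ C : ℝ, 0 ≤ C ∧ ∀ w : ℂ, 0 ≤ (w * cexp (I * θ * d)).im → ‖phiTheta d θ w‖ ≤ C := by
  refine ⟨‖(1 / Real.sqrt (2 * Real.pi) : ℂ)‖ *
    ∫ t in Set.Ioi (0 : ℝ), Real.exp (-(Real.cos (2 * θ) / 2) * t ^ 2), ?_, fun w hw => ?_⟩
  · exact mul_nonneg (norm_nonneg _) (integral_nonneg fun _ => (Real.exp_pos _).le)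
  · rw [phiTheta, norm_mul]
    refine mul_le_mul_of_nonneg_left ?_ (norm_nonneg _)
    refine norm_integral_le_of_norm_le (integrable_exp_neg_mul_sq (half_pos hθ)).integrableOn ?_
    filter_upwards [self_mem_ae_restrict measurableSet_Ioi] with t ht
    exact phiTheta_integrand_norm_le hw ht

theorem continuousOn_phiTheta (d : ℕ) (θ : ℝ) (hθ : 0 < Real.cos (2 * θ)) :
    ContinuousOn (phiTheta d θ) {w | 0 ≤ (w * cexp (I * θ * d)).im} := by
  refine ContinuousOn.mul continuousOn_const (continuousOn_of_dominated
    (bound := fun t => Real.exp (-(Real.cos (2 * θ) / 2) * t ^ 2)) ?_ ?_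
    (integrable_exp_neg_mul_sq (half_pos hθ)).integrableOn ?_)
  · intro w _
    exact (Continuous.aestronglyMeasurable (by fun_prop))
  · intro w hw
    filter_upwards [self_mem_ae_restrict measurableSet_Ioi] with t ht
    exact phiTheta_integrand_norm_le hw ht
  · exact ae_of_all _ fun t => Continuous.continuousOn (by fun_prop)

theorem differentiableAt_phiTheta (d : ℕ) (θ : ℝ) (hθ : 0 < Real.cos (2 * θ)) {w : ℂ}
    (hw : 0 < (w * cexp (I * θ * d)).im) : DifferentiableAt ℂ (phiTheta d θ) w := by
  have hopen : IsOpen {w : ℂ | 0 < (w * cexp (I * θ * d)).im} :=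
    isOpen_lt continuous_const (by fun_prop)
  have hnorm : ‖cexp (I * θ * d)‖ = 1 := by
    rw [show I * θ * d = ((θ * d : ℝ) : ℂ) * I by push_cast; ring]
    exact Complex.norm_exp_ofReal_mul_I _
  refine DifferentiableAt.const_mul ?_ _
  refine (hasDerivAt_integral_of_dominated_loc_of_deriv_le
    (F' := fun (w : ℂ) (t : ℝ) => (I * cexp (I * θ * d) * (t : ℂ) ^ d) *
      (cexp (I * w * cexp (I * θ * d) * (t : ℂ) ^ d
        - (1 / 2) * cexp (2 * I * θ) * (t : ℂ) ^ 2) * cexp (I * θ)))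
    (bound := fun t => t ^ (d : ℝ) * Real.exp (-(Real.cos (2 * θ) / 2) * t ^ 2))
    (hopen.mem_nhds hw) ?_ ?_ ?_ ?_ ?_ ?_).2.differentiableAt
  · exact Eventually.of_forall fun w => Continuous.aestronglyMeasurable (by fun_prop)
  · refine Integrable.mono' (integrable_exp_neg_mul_sq (half_pos hθ)).integrableOn
      (Continuous.aestronglyMeasurable (by fun_prop)) ?_
    filter_upwards [self_mem_ae_restrict measurableSet_Ioi] with t ht
    exact phiTheta_integrand_norm_le hw.le ht
  · exact Continuous.aestronglyMeasurable (by fun_prop)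
  · filter_upwards [self_mem_ae_restrict measurableSet_Ioi] with t ht v hv
    have ht' : (0 : ℝ) < t := ht
    rw [norm_mul, norm_mul, norm_mul, hnorm, norm_I, norm_pow, Complex.norm_real,
      Real.norm_of_nonneg ht'.le, one_mul, one_mul, Real.rpow_natCast]
    exact mul_le_mul_of_nonneg_left (phiTheta_integrand_norm_le (le_of_lt hv) ht)
      (pow_nonneg ht'.le d)
  · exact integrableOn_rpow_mul_exp_neg_mul_sq (half_pos hθ)
      (lt_of_lt_of_le (by norm_num) (Nat.cast_nonneg d))
  · refine ae_of_all _ fun t v _ => ?_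
    have h1 : HasDerivAt (fun v : ℂ => I * v * cexp (I * θ * d) * (t : ℂ) ^ d
        - (1 / 2) * cexp (2 * I * θ) * (t : ℂ) ^ 2) (I * cexp (I * θ * d) * (t : ℂ) ^ d) v := by
      have := ((((hasDerivAt_id v).const_mul I).mul_const (cexp (I * θ * d))).mul_const
        ((t : ℂ) ^ d)).sub_const ((1 / 2) * cexp (2 * I * θ) * (t : ℂ) ^ 2)
      simpa using this
    have h2 := h1.cexp.mul_const (cexp (I * θ))
    refine h2.congr_deriv ?_
    ring

theorem phiTheta_pi_add {d : ℕ} (hd : Even d) (θ : ℝ) (w : ℂ) :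
    phiTheta d (Real.pi + θ) w = -phiTheta d θ w := by
  obtain ⟨k, rfl⟩ := hd
  have h1 : cexp (I * ((Real.pi + θ : ℝ) : ℂ) * ((k + k : ℕ) : ℂ)) =
      cexp (I * θ * ((k + k : ℕ) : ℂ)) := by
    rw [show I * ((Real.pi + θ : ℝ) : ℂ) * ((k + k : ℕ) : ℂ) =
      I * θ * ((k + k : ℕ) : ℂ) + k * (2 * Real.pi * I) by push_cast; ring, Complex.exp_add,
      Complex.exp_nat_mul_two_pi_mul_I, mul_one]
  have h2 : cexp (2 * I * ((Real.pi + θ : ℝ) : ℂ)) = cexp (2 * I * θ) := by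
    rw [show 2 * I * ((Real.pi + θ : ℝ) : ℂ) = 2 * I * θ + 2 * Real.pi * I by push_cast; ring,
      Complex.exp_add, Complex.exp_two_pi_mul_I, mul_one]
  have h3 : cexp (I * ((Real.pi + θ : ℝ) : ℂ)) = -cexp (I * θ) := by
    rw [show I * ((Real.pi + θ : ℝ) : ℂ) = I * θ + Real.pi * I by push_cast; ring,
      Complex.exp_add, Complex.exp_pi_mul_I]; ring
  simp only [phiTheta, h1, h2, h3, mul_neg, integral_neg]

theorem phiTheta_neg (d : ℕ) (θ : ℝ) (w : ℂ) :
    phiTheta d (-θ) (-(starRingEnd ℂ) w) = (starRingEnd ℂ) (phiTheta d θ w) := by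
  simp only [phiTheta, map_mul, ← integral_conj]
  congr 1
  · simp
  · refine integral_congr_ae (ae_of_all _ fun t => ?_)
    simp only [map_mul, ← Complex.exp_conj, map_sub, map_pow, conj_I, conj_ofReal, map_natCast,
      map_div₀, map_one, map_ofNat, ofReal_neg]
    ring_nf

theorem psiFn_pi_add {d n : ℕ} (hd : Even d) (θ φ : ℝ) (z : ℂ) :
    psiFn d n θ (Real.pi + θ) φ z = ∫ s in Set.Ioi (0 : ℝ),
      cexp (-I * z * (cexp (I * φ) * s)) * (2 * phiTheta d θ (cexp (I * φ) * s)) ^ n *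
        cexp (I * φ) := by
  simp only [psiFn, phiTheta_pi_add hd, sub_neg_eq_add, two_mul, mul_assoc]

theorem psiFn_pi {d n : ℕ} (hd : Even d) (φ : ℝ) (z : ℂ) :
    psiFn d n 0 Real.pi φ z = ∫ s in Set.Ioi (0 : ℝ),
      cexp (-I * z * (cexp (I * φ) * s)) * (2 * phiTheta d 0 (cexp (I * φ) * s)) ^ n *
        cexp (I * φ) := by
  simpa using psiFn_pi_add (n := n) hd 0 φ z

theorem psiFn_conj {d n : ℕ} (hd : Even d) (ε x : ℝ) :
    psiFn d n (-ε) (Real.pi - ε) (Real.pi + ε * d) x =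
      -(starRingEnd ℂ) (psiFn d n ε (Real.pi + ε) (-(ε * d)) x) := by
  have h3 : cexp (I * ((Real.pi + ε * d : ℝ) : ℂ)) =
      -(starRingEnd ℂ) (cexp (I * ((-(ε * d) : ℝ) : ℂ))) := by
    rw [← Complex.exp_conj, map_mul, conj_I, conj_ofReal,
      show I * ((Real.pi + ε * d : ℝ) : ℂ) =
        -I * ((-(ε * d) : ℝ) : ℂ) + Real.pi * I by push_cast; ring,
      Complex.exp_add, Complex.exp_pi_mul_I]; ring
  rw [sub_eq_add_neg, psiFn_pi_add hd, psiFn_pi_add hd, ← integral_conj, ← integral_neg]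
  refine integral_congr_ae (ae_of_all _ fun s => ?_)
  simp only
  rw [h3]
  have h4 : -(starRingEnd ℂ) (cexp (I * ((-(ε * d) : ℝ) : ℂ))) * (s : ℂ) =
      -(starRingEnd ℂ) (cexp (I * ((-(ε * d) : ℝ) : ℂ)) * s) := by
    rw [map_mul, conj_ofReal]; ring
  rw [h4, phiTheta_neg]
  simp only [map_mul, map_pow, ← Complex.exp_conj, conj_I, conj_ofReal, map_neg, map_ofNat]
  ring_nf

/-- On the positive half-line the contour of integration defining `phiTheta` may be rotated. -/
theorem phiTheta_ofReal_eq {d : ℕ} {ε s : ℝ} (hε : 0 ≤ ε) (hεd : ε * d ≤ Real.pi)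
    (hε2 : 2 * ε < Real.pi / 2) (hs : 0 ≤ s) : phiTheta d ε s = phiTheta d 0 s := by
  set f : ℂ → ℂ := fun u => cexp (I * s * u ^ d - (1 / 2) * u ^ 2) with hf
  have hcos : 0 < Real.cos (2 * ε) :=
    Real.cos_pos_of_mem_Ioo ⟨by linarith [Real.pi_pos], hε2⟩
  have hray : ∀ η r : ℝ, f (cexp (I * η) * r) * cexp (I * η) =
      cexp (I * s * cexp (I * η * d) * (r : ℂ) ^ d
        - (1 / 2) * cexp (2 * I * η) * (r : ℂ) ^ 2) * cexp (I * η) := by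
    intro η r
    simp only [hf]
    rw [mul_pow, mul_pow, ← Complex.exp_nat_mul, ← Complex.exp_nat_mul]
    push_cast
    rw [show (d : ℂ) * (I * η) = I * η * d by ring, show (2 : ℂ) * (I * η) = 2 * I * η by ring]
    congr 2
    ring
  have hrot := integral_ray_eq_integral_ray (f := f) (U := Set.univ) (a := 0) (b := ε)
    (c := Real.cos (2 * ε) / 2) (C := Real.exp (Real.cos (2 * ε) / 2)) hε (half_pos hcos)
    (fun _ _ _ _ => Set.mem_univ _) (Continuous.continuousOn (by fun_prop))
    (fun η _ r _ => by simp only [hf]; fun_prop) ?_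
  · simp_rw [hray] at hrot
    rw [phiTheta, phiTheta, hrot]
  · intro η hη r hr
    have h1 : ‖cexp (I * η)‖ = 1 := by
      rw [mul_comm]; exact Complex.norm_exp_ofReal_mul_I η
    have hd0 : (0 : ℝ) ≤ d := Nat.cast_nonneg d
    have him : 0 ≤ ((s : ℂ) * cexp (I * η * d)).im := by
      rw [im_ofReal_mul, show I * η * d = ((η * d : ℝ) : ℂ) * I by push_cast; ring,
        Complex.exp_ofReal_mul_I_im]
      refine mul_nonneg hs (Real.sin_nonneg_of_nonneg_of_le_pi (mul_nonneg hη.1 hd0) ?_)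
      exact (mul_le_mul_of_nonneg_right hη.2 hd0).trans hεd
    have h2 := phiTheta_integrand_norm_le him hr
    rw [← hray, norm_mul, h1, mul_one] at h2
    refine h2.trans ?_
    rw [← Real.exp_add]
    refine Real.exp_le_exp.2 ?_
    have hle : Real.cos (2 * ε) ≤ Real.cos (2 * η) :=
      Real.cos_le_cos_of_nonneg_of_le_pi (by linarith [hη.1]) (by linarith [Real.pi_pos])
        (by linarith [hη.2])
    nlinarith [mul_nonneg (sub_nonneg.2 hle) (sq_nonneg r),
      mul_nonneg hcos.le (sq_nonneg (r - 1 / 2)), hcos]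

theorem integral_cexp_mul_pow_gaussianReal {d : ℕ} (hd : Even d) (s : ℝ) :
    ∫ y, cexp (I * s * (y : ℂ) ^ d) ∂(gaussianReal 0 1) = 2 * phiTheta d 0 s := by
  set h : ℝ → ℂ := fun y => cexp (I * s * (y : ℂ) ^ d - (1 / 2) * (y : ℂ) ^ 2) with hh
  have h_int : Integrable h := by
    refine (integrable_exp_neg_mul_sq (b := 1 / 2) (by norm_num)).mono'
      (Continuous.aestronglyMeasurable (by fun_prop)) (ae_of_all _ fun y => le_of_eq ?_)
    simp only [hh]
    rw [Complex.norm_exp, show I * s * (y : ℂ) ^ d - (1 / 2) * (y : ℂ) ^ 2 =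
      ((-(1 / 2) * y ^ 2 : ℝ) : ℂ) + ((s * y ^ d : ℝ) : ℂ) * I by push_cast; ring]
    rw [add_re, ofReal_re, re_ofReal_mul, I_re, mul_zero, add_zero]
  have heven : ∀ y, h (-y) = h y := by
    intro y
    simp only [hh, ofReal_neg, hd.neg_pow, neg_sq]
  have hsplit : ∫ y, h y = 2 * ∫ y in Set.Ioi (0 : ℝ), h y := by
    rw [← integral_add_compl measurableSet_Ioi h_int, Set.compl_Ioi, two_mul]
    congr 1
    have := integral_comp_neg_Ioi 0 h
    rw [neg_zero] at this
    rw [← this]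
    simp_rw [heven]
  rw [integral_gaussianReal_eq_integral_smul one_ne_zero]
  have : ∀ y : ℝ, gaussianPDFReal 0 1 y • cexp (I * s * (y : ℂ) ^ d) =
      (1 / Real.sqrt (2 * Real.pi) : ℂ) * h y := by
    intro y
    simp only [gaussianPDFReal, hh, real_smul, sub_eq_add_neg, Complex.exp_add]
    push_cast
    ring_nf
  simp_rw [this]
  rw [integral_const_mul, hsplit, phiTheta]
  simp only [hh, ofReal_zero, mul_zero, zero_mul, Complex.exp_zero, mul_one]
  ring

theorem integral_cexp_map_sum_pow {d : ℕ} (n : ℕ) (hd : Even d) (s : ℝ) :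
    ∫ y : ℝ, cexp (I * s * y) ∂(Measure.map (fun x : Fin n → ℝ => ∑ k, x k ^ d)
      (Measure.pi fun _ : Fin n => gaussianReal 0 1)) = (2 * phiTheta d 0 s) ^ n := by
  rw [integral_map (Measurable.aemeasurable (by fun_prop))
    (Continuous.aestronglyMeasurable (by fun_prop)), ← integral_cexp_mul_pow_gaussianReal hd]
  have := integral_fintype_prod_eq_pow (ι := Fin n) (𝕜 := ℂ)
    (fun y : ℝ => cexp (I * s * (y : ℂ) ^ d)) (μ := gaussianReal 0 1)
  rw [Fintype.card_fin] at this
  rw [← this]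
  refine integral_congr_ae (ae_of_all _ fun x => ?_)
  simp only
  rw [← Complex.exp_sum]
  push_cast
  rw [Finset.mul_sum]

theorem re_integral_exp_mul_integral_cexp (μ : Measure ℝ) [IsProbabilityMeasure μ] {δ : ℝ}
    (hδ : 0 < δ) (x : ℝ) :
    (∫ s in Set.Ioi (0 : ℝ), cexp (-(I * x + δ) * s) * ∫ y : ℝ, cexp (I * s * y) ∂μ).re =
      ∫ y, δ / (δ ^ 2 + (x - y) ^ 2) ∂μ := by
  have hcomb : ∀ s y : ℝ, cexp (-(I * x + δ) * s) * cexp (I * s * y) =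
      cexp (-(δ + I * (x - y)) * s) := by
    intro s y
    rw [← Complex.exp_add]; congr 1; ring
  have hre : ∀ y : ℝ, (-((δ : ℂ) + I * (x - y))).re = -δ := by
    intro y; simp
  have h_int : Integrable (Function.uncurry fun (s y : ℝ) => cexp (-(δ + I * (x - y)) * s))
      ((volume.restrict (Set.Ioi (0 : ℝ))).prod μ) := by
    have h1 : Integrable (fun p : ℝ × ℝ => Real.exp (-δ * p.1) * (1 : ℝ))
        ((volume.restrict (Set.Ioi (0 : ℝ))).prod μ) :=
      Integrable.mul_prod (exp_neg_integrableOn_Ioi 0 hδ) (integrable_const _)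
    refine h1.mono' (Continuous.aestronglyMeasurable (by
      simp only [Function.uncurry_def]; fun_prop)) (ae_of_all _ fun p => le_of_eq ?_)
    simp only [Function.uncurry]
    rw [Complex.norm_exp, re_mul_ofReal, hre, mul_one]
  have hswap : ∫ s in Set.Ioi (0 : ℝ), cexp (-(I * x + δ) * s) * ∫ y : ℝ, cexp (I * s * y) ∂μ =
      ∫ y : ℝ, (δ + I * (x - y))⁻¹ ∂μ := by
    simp_rw [← integral_const_mul, hcomb]
    rw [integral_integral_swap h_int]
    refine integral_congr_ae (ae_of_all _ fun y => ?_)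
    simp only
    rw [integral_exp_mul_complex_Ioi (by rw [hre]; linarith) 0, ofReal_zero, mul_zero,
      Complex.exp_zero, neg_div_neg_eq, one_div]
  have hinv : Integrable (fun y : ℝ => ((δ : ℂ) + I * (x - y))⁻¹) μ := by
    have hne : ∀ y : ℝ, (δ : ℂ) + I * (x - y) ≠ 0 := by
      intro y h
      have := hre y
      rw [h] at this
      simp at this
      exact hδ.ne' this
    refine Integrable.of_bound (C := δ⁻¹) (Continuous.aestronglyMeasurable
      (Continuous.inv₀ (by fun_prop) hne)) (ae_of_all _ fun y => ?_)
    rw [norm_inv]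
    refine inv_anti₀ hδ ?_
    have := Complex.abs_re_le_norm ((δ : ℂ) + I * (x - y))
    have h2 := hre y
    rw [neg_re] at h2
    rw [neg_inj.1 h2, abs_of_pos hδ] at this
    exact this
  rw [hswap]
  have := integral_re hinv
  simp only [RCLike.re_to_complex] at this
  rw [← this]
  refine integral_congr_ae (ae_of_all _ fun y => ?_)
  simp only
  rw [Complex.inv_re, Complex.normSq_apply]
  simp
  ring

theorem norm_cexp_neg_mul_ray (δ x η r : ℝ) :
    ‖cexp (-(I * x + δ) * (cexp (I * η) * r))‖ =
      Real.exp (-(δ * Real.cos η - x * Real.sin η) * r) := by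
  rw [Complex.norm_exp, ← mul_assoc, re_mul_ofReal, mul_comm I (η : ℂ), mul_re,
    Complex.exp_ofReal_mul_I_re, Complex.exp_ofReal_mul_I_im]
  congr 2
  simp
  ring

theorem ray_mul_im (η r : ℝ) (d : ℕ) (ε : ℝ) :
    (cexp (I * η) * r * cexp (I * ε * d)).im = r * Real.sin (η + ε * d) := by
  rw [show cexp (I * η) * r * cexp (I * ε * d) =
    r * cexp (((η + ε * d : ℝ) : ℂ) * I) by
      push_cast
      rw [show ((η : ℂ) + ε * d) * I = I * η + I * ε * d by ring, Complex.exp_add]; ring,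
    im_ofReal_mul, Complex.exp_ofReal_mul_I_im]

/-- The damped inversion integral along the ray of argument `φ`. -/
noncomputable def dampedRayIntegral (d n : ℕ) (θ φ δ x : ℝ) : ℂ :=
  ∫ s in Set.Ioi (0 : ℝ), cexp (-(I * x + δ) * (cexp (I * φ) * s)) *
    (2 * phiTheta d θ (cexp (I * φ) * s)) ^ n * cexp (I * φ)

theorem dampedRayIntegral_eq {d : ℕ} (n : ℕ) {θ δ x a b c : ℝ} (hθ : 0 < Real.cos (2 * θ))
    (hab : a ≤ b) (ha : 0 ≤ a + θ * d) (hb : b + θ * d ≤ Real.pi) (hc : 0 < c)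
    (hle : ∀ η ∈ Set.Icc a b, c ≤ δ * Real.cos η - x * Real.sin η) :
    dampedRayIntegral d n θ a δ x = dampedRayIntegral d n θ b δ x := by
  obtain ⟨C, hC0, hC⟩ := exists_norm_phiTheta_le d θ hθ
  have hmem : ∀ η ∈ Set.Icc a b, ∀ r : ℝ, 0 < r →
      0 ≤ (cexp (I * η) * r * cexp (I * θ * d)).im := by
    intro η hη r hr
    rw [ray_mul_im η r d θ]
    exact mul_nonneg hr.le (Real.sin_nonneg_of_nonneg_of_le_pi (by linarith [hη.1])
      (by linarith [hη.2]))
  refine integral_ray_eq_integral_ray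
    (f := fun w => cexp (-(I * x + δ) * w) * (2 * phiTheta d θ w) ^ n)
    (U := {w | 0 ≤ (w * cexp (I * θ * d)).im}) (c := c) (C := (2 * C) ^ n) hab hc hmem ?_ ?_ ?_
  · exact ContinuousOn.mul (Continuous.continuousOn (by fun_prop))
      ((continuousOn_const.mul (continuousOn_phiTheta d θ hθ)).pow n)
  · intro η hη r hr
    have hpos : 0 < (cexp (I * η) * r * cexp (I * θ * d)).im := by
      rw [ray_mul_im η r d θ]
      exact mul_pos hr (Real.sin_pos_of_pos_of_lt_pi (by linarith [hη.1]) (by linarith [hη.2]))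
    exact DifferentiableAt.mul (by fun_prop)
      (((differentiableAt_phiTheta d θ hθ hpos).const_mul 2).pow n)
  · intro η hη r hr
    rw [norm_mul, norm_cexp_neg_mul_ray, norm_pow, norm_mul, Complex.norm_ofNat, mul_comm]
    refine mul_le_mul (pow_le_pow_left₀ (by positivity)
      (mul_le_mul_of_nonneg_left (hC _ (hmem η hη r hr)) (by norm_num)) n) ?_
      (Real.exp_pos _).le (by positivity)
    refine Real.exp_le_exp.2 ?_
    nlinarith [mul_le_mul_of_nonneg_right (hle η hη) hr.le]

theorem exists_dampedRayIntegral_bound (d n : ℕ) {ε : ℝ} (hε : 0 < Real.cos (2 * ε))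
    (h0 : 0 < ε * d) (h1 : ε * d < Real.pi / 2) :
    ∃ K : ℝ, ∀ δ x : ℝ, 0 ≤ δ → 0 < x →
      ‖dampedRayIntegral d n ε (-(ε * d)) δ x‖ ≤ K / x ∧
      ∀ u : ℕ → ℝ, (∀ k, 0 ≤ u k) → Tendsto u atTop (𝓝 δ) →
        Tendsto (fun k => dampedRayIntegral d n ε (-(ε * d)) (u k) x) atTop
          (𝓝 (dampedRayIntegral d n ε (-(ε * d)) δ x)) := by
  obtain ⟨C, hC0, hC⟩ := exists_norm_phiTheta_le d ε hε
  have hsin : 0 < Real.sin (ε * d) :=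
    Real.sin_pos_of_pos_of_lt_pi h0 (by linarith [Real.pi_pos])
  have hcos : 0 < Real.cos (ε * d) :=
    Real.cos_pos_of_mem_Ioo ⟨by linarith [Real.pi_pos], h1⟩
  have hphi : ∀ s ∈ Set.Ioi (0 : ℝ), ‖2 * phiTheta d ε (cexp (I * (-(ε * d) : ℝ)) * s)‖ ≤ 2 * C := by
    intro s hs
    rw [norm_mul, Complex.norm_ofNat]
    refine mul_le_mul_of_nonneg_left (hC _ ?_) (by norm_num)
    rw [ray_mul_im _ s d ε]; simp
  have hexp : ‖cexp (I * (-(ε * d) : ℝ))‖ = 1 := by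
    rw [mul_comm]; exact Complex.norm_exp_ofReal_mul_I _
  have hbd : ∀ δ x s : ℝ, 0 ≤ δ → 0 < s →
      ‖cexp (-(I * x + δ) * (cexp (I * (-(ε * d) : ℝ)) * s)) *
        (2 * phiTheta d ε (cexp (I * (-(ε * d) : ℝ)) * s)) ^ n * cexp (I * (-(ε * d) : ℝ))‖ ≤
      (2 * C) ^ n * Real.exp (-(x * Real.sin (ε * d)) * s) := by
    intro δ x s hδ hs
    rw [norm_mul, norm_mul, norm_cexp_neg_mul_ray, norm_pow, hexp, mul_one, mul_comm]
    refine mul_le_mul (pow_le_pow_left₀ (norm_nonneg _) (hphi s hs) n) ?_ (Real.exp_pos _).le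
      (by positivity)
    refine Real.exp_le_exp.2 ?_
    rw [Real.cos_neg, Real.sin_neg]
    nlinarith [mul_nonneg (mul_nonneg hδ hcos.le) hs.le]
  have hmeas : ∀ δ x : ℝ, AEStronglyMeasurable (fun s : ℝ =>
      cexp (-(I * x + δ) * (cexp (I * (-(ε * d) : ℝ)) * s)) *
        (2 * phiTheta d ε (cexp (I * (-(ε * d) : ℝ)) * s)) ^ n * cexp (I * (-(ε * d) : ℝ)))
      (volume.restrict (Set.Ioi (0 : ℝ))) := by
    intro δ x
    refine ContinuousOn.aestronglyMeasurable ?_ measurableSet_Ioi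
    refine ContinuousOn.mul (ContinuousOn.mul (Continuous.continuousOn (by fun_prop)) ?_)
      continuousOn_const
    refine (continuousOn_const.mul ((continuousOn_phiTheta d ε hε).comp
      (Continuous.continuousOn (by fun_prop)) ?_)).pow n
    intro s hs
    change 0 ≤ (cexp (I * (-(ε * d) : ℝ)) * s * cexp (I * ε * d)).im
    rw [ray_mul_im _ s d ε]; simp
  refine ⟨(2 * C) ^ n / Real.sin (ε * d), fun δ x hδ hx => ⟨?_, fun u hu hlim => ?_⟩⟩
  · have hpos : 0 < x * Real.sin (ε * d) := mul_pos hx hsin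
    have h := norm_integral_le_of_norm_le
      ((exp_neg_integrableOn_Ioi 0 hpos).const_mul ((2 * C) ^ n))
      ((ae_restrict_iff' measurableSet_Ioi).2 (ae_of_all _ fun s hs => hbd δ x s hδ hs))
    refine h.trans (le_of_eq ?_)
    rw [integral_const_mul, integral_exp_mul_Ioi (by linarith)]
    simp
    field_simp
  · refine tendsto_integral_of_dominated_convergence
      (fun s => (2 * C) ^ n * Real.exp (-(x * Real.sin (ε * d)) * s)) (fun k => hmeas _ _)
      ((exp_neg_integrableOn_Ioi 0 (mul_pos hx hsin)).const_mul _) (fun k => ?_) ?_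
    · filter_upwards [self_mem_ae_restrict measurableSet_Ioi] with s hs
      exact hbd _ x s (hu k) hs
    · refine ae_of_all _ fun s => ?_
      have hc : Continuous fun δ : ℝ => cexp (-(I * x + δ) * (cexp (I * (-(ε * d) : ℝ)) * s)) *
        (2 * phiTheta d ε (cexp (I * (-(ε * d) : ℝ)) * s)) ^ n * cexp (I * (-(ε * d) : ℝ)) := by
        fun_prop
      exact (hc.tendsto δ).comp hlim

theorem abs_arctan_le (x : ℝ) : |Real.arctan x| ≤ Real.pi / 2 :=
  abs_le.2 ⟨(Real.neg_pi_div_two_lt_arctan x).le, (Real.arctan_lt_pi_div_two x).le⟩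

theorem intervalIntegral_poisson {δ : ℝ} (hδ : 0 < δ) (a b y : ℝ) :
    ∫ x in a..b, δ / (δ ^ 2 + (x - y) ^ 2) =
      Real.arctan ((b - y) / δ) - Real.arctan ((a - y) / δ) := by
  have hpos : ∀ x : ℝ, 0 < δ ^ 2 + (x - y) ^ 2 := fun x => by positivity
  refine intervalIntegral.integral_eq_sub_of_hasDerivAt (f := fun x => Real.arctan ((x - y) / δ))
    (fun x _ => ?_) (Continuous.intervalIntegrable ?_ _ _)
  · have h := (((hasDerivAt_id x).sub_const y).div_const δ).arctan
    refine h.congr_deriv ?_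
    have := (hpos x).ne'
    simp only [id]
    field_simp
  · exact continuous_const.div (by fun_prop) fun x => (hpos x).ne'

theorem continuous_poisson {δ : ℝ} (hδ : 0 < δ) :
    Continuous fun p : ℝ × ℝ => δ / (δ ^ 2 + (p.1 - p.2) ^ 2) :=
  continuous_const.div (by fun_prop) fun p => by positivity

theorem norm_poisson_le {δ : ℝ} (hδ : 0 < δ) (x y : ℝ) :
    ‖δ / (δ ^ 2 + (x - y) ^ 2)‖ ≤ δ⁻¹ := by
  rw [Real.norm_of_nonneg (by positivity), div_le_iff₀ (by positivity), inv_mul_eq_div,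
    le_div_iff₀ hδ]
  nlinarith [sq_nonneg (x - y)]

theorem continuous_integral_poisson (μ : Measure ℝ) [IsFiniteMeasure μ] {δ : ℝ} (hδ : 0 < δ) :
    Continuous fun x => ∫ y, δ / (δ ^ 2 + (x - y) ^ 2) ∂μ :=
  continuous_of_dominated (bound := fun _ => δ⁻¹)
    (fun x => ((continuous_poisson hδ).comp (Continuous.prodMk_right x)).aestronglyMeasurable)
    (fun x => ae_of_all _ fun y => norm_poisson_le hδ x y) (integrable_const _)
    (ae_of_all _ fun y => (continuous_poisson hδ).comp (Continuous.prodMk_left y))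

theorem intervalIntegral_integral_poisson (μ : Measure ℝ) [IsFiniteMeasure μ] {δ : ℝ}
    (hδ : 0 < δ) {a b : ℝ} (hab : a ≤ b) :
    ∫ x in a..b, (∫ y, δ / (δ ^ 2 + (x - y) ^ 2) ∂μ) =
      ∫ y, (Real.arctan ((b - y) / δ) - Real.arctan ((a - y) / δ)) ∂μ := by
  simp_rw [← intervalIntegral_poisson hδ, intervalIntegral.integral_of_le hab]
  refine integral_integral_swap (Integrable.of_bound (C := δ⁻¹)
    (continuous_poisson hδ).aestronglyMeasurable (ae_of_all _ fun p => ?_))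
  exact norm_poisson_le hδ p.1 p.2

theorem tendsto_arctan_div_sign {u : ℕ → ℝ} (hu : ∀ k, 0 < u k) (hlim : Tendsto u atTop (𝓝 0))
    (v : ℝ) :
    Tendsto (fun k => Real.arctan (v / u k)) atTop (𝓝 (Real.pi / 2 * Real.sign v)) := by
  have hinv : Tendsto (fun k => (u k)⁻¹) atTop atTop :=
    (tendsto_inv_nhdsGT_zero).comp (tendsto_nhdsWithin_iff.2 ⟨hlim, Eventually.of_forall hu⟩)
  rcases lt_trichotomy v 0 with hv | rfl | hv
  · rw [Real.sign_of_neg hv, mul_neg_one]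
    exact (tendsto_nhds_of_tendsto_nhdsWithin Real.tendsto_arctan_atBot).comp
      ((tendsto_const_mul_atBot_of_neg hv).2 hinv)
  · simp
  · rw [Real.sign_of_pos hv, mul_one]
    exact (tendsto_nhds_of_tendsto_nhdsWithin Real.tendsto_arctan_atTop).comp
      ((tendsto_const_mul_atTop_of_pos hv).2 hinv)

/-- Stieltjes inversion: if the Poisson integrals of a probability measure on the positive half-line
converge locally boundedly, the limit is, up to the factor `π`, the density of the measure. -/
theorem eq_withDensity_of_tendsto_poisson (μ : Measure ℝ) [IsProbabilityMeasure μ]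
    (h0 : μ (Set.Iic 0) = 0) {u : ℕ → ℝ} (hu : ∀ k, 0 < u k) (hu0 : Tendsto u atTop (𝓝 0))
    (G : ℝ → ℝ) (K : ℝ)
    (hlim : ∀ x, 0 < x → Tendsto (fun k => ∫ y, u k / (u k ^ 2 + (x - y) ^ 2) ∂μ) atTop
      (𝓝 (G x)))
    (hbd : ∀ k x, 0 < x → |∫ y, u k / (u k ^ 2 + (x - y) ^ 2) ∂μ| ≤ K / x) :
    AEStronglyMeasurable G (volume.restrict (Set.Ioi 0)) ∧ (∀ x, 0 < x → 0 ≤ G x) ∧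
    μ = (volume.restrict (Set.Ioi 0)).withDensity (fun x => ENNReal.ofReal (G x / Real.pi)) := by
  have hGm : AEStronglyMeasurable G (volume.restrict (Set.Ioi 0)) := by
    refine aestronglyMeasurable_of_tendsto_ae atTop
      (fun k => (continuous_integral_poisson μ (hu k)).aestronglyMeasurable) ?_
    filter_upwards [self_mem_ae_restrict measurableSet_Ioi] with x hx
    exact hlim x hx
  have hG0 : ∀ x, 0 < x → 0 ≤ G x := fun x hx =>
    ge_of_tendsto' (hlim x hx) fun k => integral_nonneg fun y =>
      div_nonneg (hu k).le (by positivity)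
  have hGK : ∀ x, 0 < x → |G x| ≤ K / x := fun x hx =>
    le_of_tendsto' (hlim x hx).abs fun k => hbd k x hx
  have hK : 0 ≤ K := by simpa using (abs_nonneg _).trans (hGK 1 one_pos)
  have hsub : ∀ {a b : ℝ}, 0 < a → Set.Ioc a b ⊆ Set.Ioi 0 := fun ha x hx => ha.trans hx.1
  have hGa : ∀ {a x : ℝ}, 0 < a → a ≤ x → |G x| ≤ K / a := fun ha hx =>
    (hGK _ (ha.trans_le hx)).trans (div_le_div_of_nonneg_left hK ha hx)
  have hGint : ∀ {a b : ℝ}, 0 < a → IntegrableOn G (Set.Ioc a b) := by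
    intro a b ha
    refine IntegrableOn.of_bound (C := K / a) measure_Ioc_lt_top
      (hGm.mono_measure (Measure.restrict_mono (hsub ha) le_rfl)) ?_
    filter_upwards [self_mem_ae_restrict measurableSet_Ioc] with x hx
    exact hGa ha hx.1.le
  have hmain : ∀ {a b : ℝ}, 0 < a → a ≤ b → ∫ x in a..b, G x =
      ∫ y, (Real.pi / 2 * Real.sign (b - y) - Real.pi / 2 * Real.sign (a - y)) ∂μ := by
    intro a b ha hab
    have l1 : Tendsto (fun k => ∫ x in a..b, (∫ y, u k / (u k ^ 2 + (x - y) ^ 2) ∂μ)) atTop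
        (𝓝 (∫ x in a..b, G x)) := by
      refine intervalIntegral.tendsto_integral_filter_of_dominated_convergence (fun _ => K / a)
        (Eventually.of_forall fun k =>
          (continuous_integral_poisson μ (hu k)).aestronglyMeasurable)
        (Eventually.of_forall fun k => ae_of_all _ fun x hx => ?_) (by simp)
        (ae_of_all _ fun x hx => ?_)
      · rw [Set.uIoc_of_le hab] at hx
        exact (hbd k x (hsub ha hx)).trans (div_le_div_of_nonneg_left hK ha hx.1.le)
      · rw [Set.uIoc_of_le hab] at hx
        exact hlim x (hsub ha hx)
    have l2 : Tendsto (fun k => ∫ y, (Real.arctan ((b - y) / u k) -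
        Real.arctan ((a - y) / u k)) ∂μ) atTop (𝓝 (∫ y, (Real.pi / 2 * Real.sign (b - y) -
          Real.pi / 2 * Real.sign (a - y)) ∂μ)) := by
      refine tendsto_integral_of_dominated_convergence (fun _ => Real.pi / 2 + Real.pi / 2)
        (fun k => Continuous.aestronglyMeasurable (by fun_prop)) (integrable_const _)
        (fun k => ae_of_all _ fun y => ?_) (ae_of_all _ fun y => ?_)
      · exact (norm_sub_le _ _).trans (add_le_add (abs_arctan_le _) (abs_arctan_le _))
      · exact (tendsto_arctan_div_sign hu hu0 _).sub (tendsto_arctan_div_sign hu hu0 _)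
    simp_rw [intervalIntegral_integral_poisson μ (hu _) hab] at l1
    exact tendsto_nhds_unique l1 l2
  have hsign : Measurable Real.sign := by
    unfold Real.sign
    exact Measurable.ite measurableSet_Iio measurable_const
      (Measurable.ite measurableSet_Ioi measurable_const measurable_const)
  have hsign1 : ∀ v, |Real.sign v| ≤ 1 := by
    intro v
    rcases Real.sign_apply_eq v with h | h | h <;> simp [h]
  have hsint : ∀ a b : ℝ, Integrable (fun y => Real.pi / 2 * Real.sign (b - y) -
      Real.pi / 2 * Real.sign (a - y)) μ := by
    have h : ∀ a : ℝ, Integrable (fun y => Real.pi / 2 * Real.sign (a - y)) μ := fun a =>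
      (Integrable.of_bound (C := 1) (hsign.comp (by fun_prop)).aestronglyMeasurable
        (ae_of_all _ fun y => hsign1 _)).const_mul _
    exact fun a b => (h b).sub (h a)
  have hatom : ∀ a, 0 < a → μ {a} = 0 := by
    intro a ha
    have hle : ∀ h : ℝ, 0 < h → h ≤ a / 2 → Real.pi * μ.real {a} ≤ K / (a / 2) * (2 * h) := by
      intro h hh hha
      have h1 : Real.pi * μ.real {a} ≤ ∫ x in (a - h)..(a + h), G x := by
        rw [hmain (by linarith) (by linarith)]
        have h2 : Real.pi * μ.real {a} = ∫ y, Set.indicator {a} (fun _ => Real.pi) y ∂μ := by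
          rw [integral_indicator_const _ (measurableSet_singleton a), smul_eq_mul, mul_comm]
        rw [h2]
        refine integral_mono ((integrable_const _).indicator (measurableSet_singleton a))
          (hsint _ _) fun y => ?_
        by_cases hy : y = a
        · subst hy
          simp only [Set.mem_singleton_iff, Set.indicator_of_mem]
          rw [Real.sign_of_pos (by linarith), Real.sign_of_neg (by linarith)]
          linarith
        · rw [Set.indicator_of_notMem (by simpa using hy)]
          rcases lt_trichotomy (a - h - y) 0 with h3 | h3 | h3
          · rw [Real.sign_of_neg h3]
            have := (abs_le.1 (hsign1 (a + h - y))).1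
            nlinarith [Real.pi_pos]
          · rw [h3, Real.sign_zero, Real.sign_of_pos (by linarith)]
            nlinarith [Real.pi_pos]
          · rw [Real.sign_of_pos h3, Real.sign_of_pos (by linarith)]
            simp
      refine h1.trans ((le_abs_self _).trans ?_)
      have := intervalIntegral.norm_integral_le_of_norm_le_const (a := a - h) (b := a + h)
        (f := G) (C := K / (a / 2)) fun x hx => by
          rw [Set.uIoc_of_le (by linarith)] at hx
          exact hGa (half_pos ha) (by linarith [hx.1])
      rwa [show a + h - (a - h) = 2 * h by ring, abs_of_pos (by linarith : 0 < 2 * h)] at this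
    have hT : Tendsto (fun h : ℝ => K / (a / 2) * (2 * h)) (𝓝[>] 0) (𝓝 0) := by
      have : Continuous fun h : ℝ => K / (a / 2) * (2 * h) := by fun_prop
      simpa using (this.tendsto 0).mono_left nhdsWithin_le_nhds
    have h4 : Real.pi * μ.real {a} ≤ 0 := by
      refine ge_of_tendsto hT ?_
      filter_upwards [Ioo_mem_nhdsGT (half_pos ha)] with h hh
      exact hle h hh.1 hh.2.le
    have h5 : μ.real {a} = 0 := le_antisymm (by nlinarith [Real.pi_pos]) measureReal_nonneg
    exact (measureReal_eq_zero_iff).1 h5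
  have hIoc : ∀ {a b : ℝ}, 0 < a → a ≤ b →
      ∫ x in Set.Ioc a b, G x = Real.pi * μ.real (Set.Ioc a b) := by
    intro a b ha hab
    rw [← intervalIntegral.integral_of_le hab, hmain ha hab]
    have h2 : Real.pi * μ.real (Set.Ioc a b) =
        ∫ y, Set.indicator (Set.Ioc a b) (fun _ => Real.pi) y ∂μ := by
      rw [integral_indicator_const _ measurableSet_Ioc, smul_eq_mul, mul_comm]
    rw [h2]
    refine integral_congr_ae ?_
    filter_upwards [compl_mem_ae_iff.2 (hatom a ha), compl_mem_ae_iff.2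
      (hatom b (ha.trans_le hab))] with y hya hyb
    have hya' : y ≠ a := hya
    have hyb' : y ≠ b := hyb
    rcases lt_or_gt_of_ne hya' with h | h
    · rw [Set.indicator_of_notMem (fun hy => h.not_gt hy.1), Real.sign_of_pos (by linarith),
        Real.sign_of_pos (by linarith), sub_self]
    · rcases lt_or_gt_of_ne hyb' with h' | h'
      · rw [Set.indicator_of_mem (Set.mem_Ioc.2 ⟨h, h'.le⟩), Real.sign_of_pos (by linarith),
          Real.sign_of_neg (by linarith)]
        ring
      · rw [Set.indicator_of_notMem (fun hy => h'.not_ge hy.2), Real.sign_of_neg (by linarith),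
          Real.sign_of_neg (by linarith), sub_self]
  refine ⟨hGm, hG0, ?_⟩
  set ν : Measure ℝ :=
    (volume.restrict (Set.Ioi 0)).withDensity (fun x => ENNReal.ofReal (G x / Real.pi)) with hν
  have hν0 : ν (Set.Iic 0) = 0 := by
    rw [hν, withDensity_apply _ measurableSet_Iic, Measure.restrict_restrict measurableSet_Iic]
    have : Set.Iic (0 : ℝ) ∩ Set.Ioi 0 = ∅ := by
      ext x; simp
    simp [this]
  have hpos : ∀ {a b : ℝ}, 0 < a → μ (Set.Ioc a b) = ν (Set.Ioc a b) := by
    intro a b ha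
    rcases le_total a b with hab | hab
    · rw [hν, withDensity_apply _ measurableSet_Ioc, Measure.restrict_restrict measurableSet_Ioc,
        Set.inter_eq_left.2 (hsub ha), ← ofReal_integral_eq_lintegral_ofReal
          ((hGint ha).div_const _), integral_div, hIoc ha hab,
        mul_div_cancel_left₀ _ Real.pi_ne_zero, ofReal_measureReal]
      filter_upwards [self_mem_ae_restrict measurableSet_Ioc] with x hx
      exact div_nonneg (hG0 x (hsub ha hx)) Real.pi_pos.le
    · simp [Set.Ioc_eq_empty_of_le hab]
  have hzero : ∀ b : ℝ, μ (Set.Ioc 0 b) = ν (Set.Ioc 0 b) := by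
    intro b
    have hU : Set.Ioc 0 b = ⋃ k : ℕ, Set.Ioc (1 / ((k : ℝ) + 1)) b := by
      ext x
      simp only [Set.mem_Ioc, Set.mem_iUnion]
      constructor
      · rintro ⟨h1, h2⟩
        obtain ⟨k, hk⟩ := exists_nat_one_div_lt h1
        exact ⟨k, hk, h2⟩
      · rintro ⟨k, h1, h2⟩
        exact ⟨lt_trans (by positivity) h1, h2⟩
    have hmono : Monotone fun k : ℕ => Set.Ioc (1 / ((k : ℝ) + 1)) b := fun i j hij =>
      Set.Ioc_subset_Ioc_left (one_div_le_one_div_of_le (by positivity) (by gcongr))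
    have t1 := tendsto_measure_iUnion_atTop (μ := μ) hmono
    have t2 := tendsto_measure_iUnion_atTop (μ := ν) hmono
    rw [← hU] at t1 t2
    refine tendsto_nhds_unique t1 (t2.congr fun k => ?_)
    exact (hpos (by positivity)).symm
  refine Measure.ext_of_Ioc _ _ fun a b hab => ?_
  rcases lt_or_ge 0 a with ha | ha
  · exact hpos ha
  · have key : ∀ ρ : Measure ℝ, ρ (Set.Iic 0) = 0 → ρ (Set.Ioc a b) = ρ (Set.Ioc 0 b) := by
      intro ρ hρ
      refine measure_congr ?_
      filter_upwards [compl_mem_ae_iff.2 hρ] with x hx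
      have hx' : 0 < x := not_le.1 hx
      exact propext ⟨fun h => ⟨hx', h.2⟩, fun h => ⟨ha.trans_lt h.1, h.2⟩⟩
    rw [key μ h0, key ν hν0, hzero]

theorem map_sum_pow_Iic_zero {d n : ℕ} (hd : Even d) (hd0 : d ≠ 0) (hn : 1 ≤ n) :
    Measure.map (fun x : Fin n → ℝ => ∑ k, x k ^ d)
      (Measure.pi fun _ : Fin n => gaussianReal 0 1) (Set.Iic 0) = 0 := by
  rw [Measure.map_apply (by fun_prop) measurableSet_Iic]
  have : NeZero n := ⟨by omega⟩
  refine measure_mono_null (t := {x : Fin n → ℝ | x 0 = 0}) ?_ ?_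
  · intro x hx
    have hx' : ∑ k, x k ^ d ≤ 0 := hx
    have h := (Finset.sum_eq_zero_iff_of_nonneg fun k _ => hd.pow_nonneg (x k)).1
      (le_antisymm hx' (Finset.sum_nonneg fun k _ => hd.pow_nonneg (x k))) 0 (Finset.mem_univ _)
    exact (pow_eq_zero_iff hd0).1 h
  · have : NullSingletonClass (gaussianReal 0 1) :=
      nullSingletonClass_gaussianReal one_ne_zero
    exact Measure.pi_hyperplane (fun _ : Fin n => gaussianReal 0 1) 0 0

theorem stmt_16 (d n : ℕ) (hd : 4 ≤ d) (heven : Even d) (hn : 1 ≤ n)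
    (μ : Measure ℝ)
    (hμ : μ = Measure.map (fun x : Fin n → ℝ => ∑ k, x k ^ d)
      (Measure.pi fun _ : Fin n => gaussianReal 0 1)) :
    ∃ ε₀ : ℝ, 0 < ε₀ ∧ ∀ ε : ℝ, 0 < ε → ε < ε₀ →
      ∀ g : ℝ → ℂ,
        (∀ x : ℝ, 0 < x → g x = (1 / (2 * Real.pi)) *
          (psiFn d n ε (Real.pi + ε) (-(ε * d)) x -
            psiFn d n (-ε) (Real.pi - ε) (Real.pi + ε * d) x)) →
        (∀ x : ℝ, x < 0 → g x = (1 / (2 * Real.pi)) *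
          (psiFn d n 0 Real.pi (ε * d) x -
            psiFn d n 0 Real.pi (Real.pi - ε * d) x)) →
        g 0 = 0 →
        (∀ᵐ x : ℝ ∂volume, (g x).im = 0) ∧
        ∀ A : Set ℝ, MeasurableSet A →
          (∫ x in A, g x ∂volume) = (((μ A).toReal : ℝ) : ℂ) := by
  have hπ := Real.pi_pos
  have hd4 : (4 : ℝ) ≤ d := by exact_mod_cast hd
  have hdpos : (0 : ℝ) < d := by linarith
  refine ⟨Real.pi / 2 / d, by positivity, fun ε hε hεlt g hgpos hgneg hg0 => ?_⟩
  have hεd : ε * d < Real.pi / 2 := (lt_div_iff₀ hdpos).1 hεlt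
  have hεd0 : 0 < ε * d := mul_pos hε hdpos
  have hε2 : 2 * ε < Real.pi / 2 := by nlinarith
  have hcos2 : 0 < Real.cos (2 * ε) := Real.cos_pos_of_mem_Ioo ⟨by linarith, hε2⟩
  have hcosd : 0 < Real.cos (ε * d) := Real.cos_pos_of_mem_Ioo ⟨by linarith, hεd⟩
  have hsind : 0 < Real.sin (ε * d) := Real.sin_pos_of_pos_of_lt_pi hεd0 (by linarith)
  have hprob : IsProbabilityMeasure μ := by
    rw [hμ]
    exact Measure.isProbabilityMeasure_map (Measurable.aemeasurable (by fun_prop))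
  have hμ0 : μ (Set.Iic 0) = 0 := by
    rw [hμ]; exact map_sum_pow_Iic_zero heven (by omega) hn
  have hpsi : ∀ x : ℝ, psiFn d n ε (Real.pi + ε) (-(ε * d)) x =
      dampedRayIntegral d n ε (-(ε * d)) 0 x := by
    intro x
    rw [psiFn_pi_add heven, dampedRayIntegral]
    simp
  have hpsi0 : ∀ x φ : ℝ, psiFn d n 0 Real.pi φ x = dampedRayIntegral d n 0 φ 0 x := by
    intro x φ
    rw [psiFn_pi heven, dampedRayIntegral]
    simp
  obtain ⟨K, hK⟩ := exists_dampedRayIntegral_bound d n hcos2 hεd0 hεd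
  set G : ℝ → ℝ := fun x => (dampedRayIntegral d n ε (-(ε * d)) 0 x).re with hG
  have hpoisson : ∀ δ x : ℝ, 0 < δ → 0 < x → ∫ y, δ / (δ ^ 2 + (x - y) ^ 2) ∂μ =
      (dampedRayIntegral d n ε (-(ε * d)) δ x).re := by
    intro δ x hδ hx
    rw [dampedRayIntegral_eq (b := 0) (c := δ * Real.cos (ε * d)) n hcos2 (by linarith)
      (by linarith) (by linarith) (mul_pos hδ hcosd), ← re_integral_exp_mul_integral_cexp μ hδ,
      dampedRayIntegral]
    · congr 1
      refine setIntegral_congr_fun measurableSet_Ioi fun s hs => ?_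
      simp only [ofReal_zero, mul_zero, Complex.exp_zero, one_mul, mul_one]
      rw [hμ, integral_cexp_map_sum_pow n heven,
        phiTheta_ofReal_eq hε.le (by linarith) hε2 (le_of_lt hs)]
    · intro η hη
      have h1 : Real.cos (ε * d) ≤ Real.cos η := by
        rw [← Real.cos_neg η]
        exact Real.cos_le_cos_of_nonneg_of_le_pi (by linarith [hη.2]) (by linarith)
          (by linarith [hη.1])
      have h2 : Real.sin η ≤ 0 :=
        Real.sin_nonpos_of_nonpos_of_neg_pi_le hη.2 (by linarith [hη.1])
      nlinarith
  obtain ⟨hGm, hG0, hdens⟩ := eq_withDensity_of_tendsto_poisson μ hμ0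
    (u := fun k : ℕ => 1 / ((k : ℝ) + 1)) (fun k => by positivity)
    tendsto_one_div_add_atTop_nhds_zero_nat G K
    (fun x hx => by
      simp_rw [fun k : ℕ => hpoisson (1 / ((k : ℝ) + 1)) x (by positivity) hx]
      exact (Complex.continuous_re.tendsto _).comp ((hK 0 x le_rfl hx).2 _
        (fun k => by positivity) tendsto_one_div_add_atTop_nhds_zero_nat))
    (fun k x hx => by
      rw [hpoisson _ x (by positivity) hx]
      exact (Complex.abs_re_le_norm _).trans (hK _ x (by positivity) hx).1)
  have hg : g = fun x => (((Set.Ioi (0 : ℝ)).indicator (fun x => G x / Real.pi) x : ℝ) : ℂ) := by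
    funext x
    rcases lt_trichotomy x 0 with hx | rfl | hx
    · rw [hgneg x hx, hpsi0, hpsi0, dampedRayIntegral_eq (b := Real.pi - ε * d)
        (c := -x * Real.sin (ε * d)) n (by simp) (by linarith) (by simpa using hεd0.le)
        (by simpa using hεd0.le) (mul_pos (by linarith) hsind), sub_self, mul_zero,
        Set.indicator_of_notMem (by simpa using hx.le), ofReal_zero]
      intro η hη
      have h1 : Real.sin (ε * d) ≤ Real.sin η := by
        rcases le_total η (Real.pi / 2) with h | h
        · exact Real.sin_le_sin_of_le_of_le_pi_div_two (by linarith) h hη.1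
        · rw [← Real.sin_pi_sub η]
          exact Real.sin_le_sin_of_le_of_le_pi_div_two (by linarith) (by linarith)
            (by linarith [hη.2])
      nlinarith
    · simpa using hg0
    · rw [hgpos x hx, psiFn_conj heven, sub_neg_eq_add, Complex.add_conj, hpsi,
        Set.indicator_of_mem (Set.mem_Ioi.2 hx)]
      simp only [hG]
      push_cast
      have : (Real.pi : ℂ) ≠ 0 := by exact_mod_cast Real.pi_ne_zero
      field_simp
  refine ⟨ae_of_all _ fun x => by rw [hg, ofReal_im], fun A hA => ?_⟩
  simp only [hg]
  rw [integral_complex_ofReal]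
  congr 1
  rw [hdens, withDensity_apply _ hA, Measure.restrict_restrict hA,
    setIntegral_indicator measurableSet_Ioi, integral_eq_lintegral_of_nonneg_ae]
  · filter_upwards [self_mem_ae_restrict (hA.inter measurableSet_Ioi)] with x hx
    exact div_nonneg (hG0 x hx.2) hπ.le
  · simp_rw [div_eq_mul_inv]
    exact (hGm.mono_measure (Measure.restrict_mono Set.inter_subset_right le_rfl)).mul_const _
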